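/- The fibered filled Julia set E equals the spectrum of the transition operator S acting on l^∞, and this spectrum equals the point spectrum of S on l^∞; consequently the residual and continuous spectra of S on l^∞ are empty. -/

import Mathlib

open Filter Finset
open scoped ENNReal Topology ZeroAtInfty

noncomputable section

namespace AMFC

/-- `q d j = d 0 * d 1 * ... * d j`. -/
def q (d : ℕ → ℕ) (j : ℕ) : ℕ := ∏ i ∈ Finset.range (j + 1), d i

/-- For `j ≥ 1`, `digit d n j = ⌊n / q_{j-1}⌋ mod d_j` is the `j`-th digit of `n`
in the Cantor system of numeration. -/
def digit (d : ℕ → ℕ) (n j : ℕ) : ℕ := (n / q d (j - 1)) % d j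

/-- The counter `ζ_n = min { j ≥ 1 : a_j(n) ≠ d_j - 1 }`. -/
def zeta (d : ℕ → ℕ) (n : ℕ) : ℕ := sInf {j | 1 ≤ j ∧ digit d n j ≠ d j - 1}

open scoped Classical in
/-- The transition probabilities of the stochastic adding machine. -/
def s (d : ℕ → ℕ) (p : ℕ → ℝ) (n m : ℕ) : ℝ :=
  if m = n + 1 then ∏ j ∈ Finset.Icc 1 (zeta d n), p j
  else if m = n then 1 - p 1
  else if h : ∃ r, 1 ≤ r ∧ r + 1 ≤ zeta d n ∧
      n = m + ∑ j ∈ Finset.Icc 1 r, (d j - 1) * q d (j - 1)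
    then (1 - p (h.choose + 1)) * ∏ j ∈ Finset.Icc 1 h.choose, p j
  else 0

/-- `f j (z) = ((z - (1 - p j)) / p j) ^ (d j)`. -/
def f (d : ℕ → ℕ) (p : ℕ → ℝ) (j : ℕ) (z : ℂ) : ℂ :=
  ((z - (1 - (p j : ℂ))) / (p j : ℂ)) ^ d j

/-- `ftil j = f j ∘ ... ∘ f 1`, with `ftil 0 = id`. -/
def ftil (d : ℕ → ℕ) (p : ℕ → ℝ) : ℕ → ℂ → ℂ
  | 0 => id
  | j + 1 => f d p (j + 1) ∘ ftil d p j

/-- The fibered filled Julia set `E = {z : limsup_j |ftil j z| < ∞}`. -/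
def E (d : ℕ → ℕ) (p : ℕ → ℝ) : Set ℂ :=
  {z | Filter.limsup (fun j => (‖ftil d p j z‖₊ : ℝ≥0∞)) Filter.atTop < ⊤}

/-- `ι_λ(r) = (ftil (r-1) λ - (1 - p r)) / p r` for `r ≥ 1`. -/
def iota (d : ℕ → ℕ) (p : ℕ → ℝ) (lam : ℂ) (r : ℕ) : ℂ :=
  (ftil d p (r - 1) lam - (1 - (p r : ℂ))) / (p r : ℂ)

/-- `v_λ(n) = ∏_{r ≥ 1} ι_λ(r) ^ a_r(n)`, a finite product. -/
def vlam (d : ℕ → ℕ) (p : ℕ → ℝ) (lam : ℂ) (n : ℕ) : ℂ :=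
  ∏ᶠ r : ℕ, iota d p lam (r + 1) ^ digit d n (r + 1)

/-- The point spectrum of a continuous linear operator. -/
def pointSpectrum {M : Type*} [NormedAddCommGroup M] [NormedSpace ℂ M]
    (T : M →L[ℂ] M) : Set ℂ :=
  {lam | ∃ v, v ≠ 0 ∧ T v = lam • v}

/-- The residual spectrum: `T - λI` is injective but its range is not dense. -/
def residualSpectrum {M : Type*} [NormedAddCommGroup M] [NormedSpace ℂ M]
    (T : M →L[ℂ] M) : Set ℂ :=
  {lam | Function.Injective ⇑(T - lam • (1 : M →L[ℂ] M)) ∧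
    ¬ DenseRange ⇑(T - lam • (1 : M →L[ℂ] M))}

/-- The continuous spectrum: `T - λI` is injective with dense range, but not surjective. -/
def continuousSpectrum {M : Type*} [NormedAddCommGroup M] [NormedSpace ℂ M]
    (T : M →L[ℂ] M) : Set ℂ :=
  {lam | Function.Injective ⇑(T - lam • (1 : M →L[ℂ] M)) ∧
    DenseRange ⇑(T - lam • (1 : M →L[ℂ] M)) ∧
    Set.range ⇑(T - lam • (1 : M →L[ℂ] M)) ≠ Set.univ}


section Helpers

variable {d : ℕ → ℕ} {p : ℕ → ℝ}

lemma div_lt_aux {k D : ℕ} (hD : 2 ≤ D) (h : ¬ k % D + 1 < D) : k / D < k := by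
  rcases Nat.eq_zero_or_pos k with rfl | hk
  · simp at h; omega
  · exact Nat.div_lt_self hk (by omega)

/-- The transition operators at level `j`, by recursion. -/
def SS (d : ℕ → ℕ) (p : ℕ → ℝ) (hd : ∀ j, 1 ≤ j → 2 ≤ d j) (k : ℕ) (j : ℕ) (u : ℕ → ℂ) : ℂ :=
  (1 - (p (j + 1) : ℂ)) * u k + (p (j + 1) : ℂ) *
    (if h : k % d (j + 1) + 1 < d (j + 1) then u (k + 1)
      else SS d p hd (k / d (j + 1)) (j + 1) (fun m => u (d (j + 1) * m)))
termination_by k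
decreasing_by exact div_lt_aux (hd _ (by omega)) h

def BB (d : ℕ → ℕ) (p : ℕ → ℝ) (hd : ∀ j, 1 ≤ j → 2 ≤ d j) (j : ℕ) (u : ℕ → ℂ) (k : ℕ) : ℂ :=
  if k % d (j + 1) + 1 < d (j + 1) then u (k + 1)
      else SS d p hd (k / d (j + 1)) (j + 1) (fun m => u (d (j + 1) * m))

lemma SS_eq (hd : ∀ j, 1 ≤ j → 2 ≤ d j) (k j : ℕ) (u : ℕ → ℂ) :
    SS d p hd k j u = (1 - (p (j + 1) : ℂ)) * u k + (p (j + 1) : ℂ) * BB d p hd j u k := by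
  rw [SS, BB]
  simp only [dite_eq_ite]

lemma SS_norm (hd : ∀ j, 1 ≤ j → 2 ≤ d j) (hp : ∀ j, 1 ≤ j → p j ∈ Set.Ioc (0 : ℝ) 1)
    (C : ℝ) (k : ℕ) : ∀ (j : ℕ) (u : ℕ → ℂ), (∀ m, ‖u m‖ ≤ C) → ‖SS d p hd k j u‖ ≤ C := by
  induction k using Nat.strong_induction_on with
  | _ k ih =>
    intro j u hu
    obtain ⟨h0, h1⟩ := hp (j + 1) (by omega)
    have hB : ‖BB d p hd j u k‖ ≤ C := by
      rw [BB]
      split_ifs with h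
      · exact hu _
      · exact ih _ (div_lt_aux (hd _ (by omega)) h) _ _ (fun m => hu _)
    rw [SS_eq]
    have e : (1 - (p (j + 1) : ℂ)) = ((1 - p (j + 1) : ℝ) : ℂ) := by push_cast; rfl
    calc _ ≤ ‖(1 - (p (j + 1) : ℂ)) * u k‖ + ‖(p (j + 1) : ℂ) * BB d p hd j u k‖ := norm_add_le _ _
      _ = (1 - p (j + 1)) * ‖u k‖ + p (j + 1) * ‖BB d p hd j u k‖ := by
        rw [norm_mul, norm_mul, e, Complex.norm_real, Complex.norm_real, Real.norm_of_nonneg h0.le,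
          Real.norm_of_nonneg (by linarith)]
      _ ≤ (1 - p (j + 1)) * C + p (j + 1) * C := by
        have h2 : 0 ≤ 1 - p (j + 1) := by linarith
        exact add_le_add (mul_le_mul_of_nonneg_left (hu k) h2) (mul_le_mul_of_nonneg_left hB h0.le)
      _ = C := by ring

lemma BB_iter (hd : ∀ j, 1 ≤ j → 2 ≤ d j) (j k : ℕ) (i : ℕ) : ∀ (a : ℕ) (u : ℕ → ℂ),
    a + i < d (j + 1) →
    ((BB d p hd j)^[i] u) (a + d (j + 1) * k) = u (a + i + d (j + 1) * k) := by
  induction i with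
  | zero => intro a u _; rfl
  | succ i ih =>
    intro a u h
    rw [Function.iterate_succ_apply', BB]
    have h1 : (a + d (j + 1) * k) % d (j + 1) = a := by
      rw [Nat.add_mul_mod_self_left, Nat.mod_eq_of_lt (by omega)]
    rw [if_pos (by omega)]
    have := ih (a + 1) u (by omega)
    rw [show a + d (j + 1) * k + 1 = a + 1 + d (j + 1) * k by ring, this]
    congr 1; ring

lemma BB_pow (hd : ∀ j, 1 ≤ j → 2 ≤ d j) (j k a : ℕ) (u : ℕ → ℂ) (ha : a < d (j + 1)) :
    ((BB d p hd j)^[d (j + 1)] u) (a + d (j + 1) * k) =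
      SS d p hd k (j + 1) (fun m => u (a + d (j + 1) * m)) := by
  have hD := hd (j + 1) (by omega)
  have e : d (j + 1) = (d (j + 1) - 1 - a) + (a + 1) := by omega
  have e2 : (BB d p hd j)^[d (j + 1)] u
      = (BB d p hd j)^[d (j + 1) - 1 - a] ((BB d p hd j)^[a + 1] u) := by
    rw [← Function.iterate_add_apply, ← e]
  rw [e2, BB_iter hd j k _ a _ (by omega), Function.iterate_succ_apply', BB]
  have h1 : (a + (d (j + 1) - 1 - a) + d (j + 1) * k) % d (j + 1) = d (j + 1) - 1 := by
    rw [Nat.add_mul_mod_self_left, Nat.mod_eq_of_lt (by omega)]; omega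
  have h2 : (a + (d (j + 1) - 1 - a) + d (j + 1) * k) / d (j + 1) = k := by
    rw [Nat.add_mul_div_left _ _ (by omega), Nat.div_eq_of_lt (by omega)]; omega
  rw [if_neg (by omega), h2]
  congr 1
  funext m
  have := BB_iter (p := p) hd j m a 0 u (by omega)
  simpa using this

/-- eigenvector -/
def vv (d : ℕ → ℕ) (p : ℕ → ℝ) (hd : ∀ j, 1 ≤ j → 2 ≤ d j) (lam : ℂ) (k j : ℕ) : ℂ :=
  if h : k = 0 then 1 else
    iota d p lam (j + 1) ^ (k % d (j + 1)) * vv d p hd lam (k / d (j + 1)) (j + 1)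
termination_by k
decreasing_by exact Nat.div_lt_self (by omega) (by have := hd (j + 1) (by omega); omega)

lemma vv_zero (hd : ∀ j, 1 ≤ j → 2 ≤ d j) (lam : ℂ) (j : ℕ) : vv d p hd lam 0 j = 1 := by
  rw [vv]; simp

lemma vv_eq (hd : ∀ j, 1 ≤ j → 2 ≤ d j) (lam : ℂ) (k j : ℕ) : vv d p hd lam k j =
    iota d p lam (j + 1) ^ (k % d (j + 1)) * vv d p hd lam (k / d (j + 1)) (j + 1) := by
  rcases Nat.eq_zero_or_pos k with rfl | hk
  · simp [vv_zero]
  · rw [vv, dif_neg (by omega)]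

lemma ftil_succ (j : ℕ) (lam : ℂ) :
    ftil d p (j + 1) lam = iota d p lam (j + 1) ^ d (j + 1) := rfl

lemma iota_mul (hp : ∀ j, 1 ≤ j → p j ∈ Set.Ioc (0 : ℝ) 1) (j : ℕ) (lam : ℂ) :
    (1 - (p (j + 1) : ℂ)) + p (j + 1) * iota d p lam (j + 1) = ftil d p j lam := by
  have h0 : (p (j + 1) : ℂ) ≠ 0 := by
    have := (hp (j + 1) (by omega)).1
    exact_mod_cast this.ne'
  rw [iota, Nat.add_sub_cancel]
  field_simp
  ring

lemma vv_eig (hd : ∀ j, 1 ≤ j → 2 ≤ d j) (hp : ∀ j, 1 ≤ j → p j ∈ Set.Ioc (0 : ℝ) 1)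
    (lam : ℂ) (k : ℕ) : ∀ j, SS d p hd k j (fun m => vv d p hd lam m j) =
      ftil d p j lam * vv d p hd lam k j := by
  induction k using Nat.strong_induction_on with
  | _ k ih =>
    intro j
    have hD := hd (j + 1) (by omega)
    have hB : BB d p hd j (fun m => vv d p hd lam m j) k =
        iota d p lam (j + 1) * vv d p hd lam k j := by
      rw [BB]
      split_ifs with h
      · rw [vv_eq hd lam (k + 1), vv_eq hd lam k]
        have h1 : (k + 1) % d (j + 1) = k % d (j + 1) + 1 := by
          rw [Nat.add_mod, Nat.mod_eq_of_lt (show 1 < d (j + 1) by omega), Nat.mod_eq_of_lt h]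
        have h2 : (k + 1) / d (j + 1) = k / d (j + 1) := by
          rw [Nat.succ_div, if_neg, add_zero]
          intro hh
          have := Nat.mod_eq_zero_of_dvd hh
          omega
        rw [h1, h2, pow_succ]; ring
      · have h1 : ∀ m, vv d p hd lam (d (j + 1) * m) j = vv d p hd lam m (j + 1) := by
          intro m
          rw [vv_eq]
          simp [Nat.mul_div_cancel_left m (show 0 < d (j + 1) by omega)]
        simp only [h1]
        rw [ih _ (div_lt_aux hD h), ftil_succ, vv_eq hd lam k]
        have h3 : k % d (j + 1) + 1 = d (j + 1) := by
          have := Nat.mod_lt k (show 0 < d (j + 1) by omega)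
          omega
        rw [← mul_assoc, ← pow_succ', h3]
    rw [SS_eq, hB, ← iota_mul hp]
    ring

lemma vv_norm (hd : ∀ j, 1 ≤ j → 2 ≤ d j) (lam : ℂ)
    (h : ∀ j, ‖iota d p lam (j + 1)‖ ≤ 1) (k : ℕ) : ∀ j, ‖vv d p hd lam k j‖ ≤ 1 := by
  induction k using Nat.strong_induction_on with
  | _ k ih =>
    intro j
    rcases Nat.eq_zero_or_pos k with rfl | hk
    · simp [vv_zero]
    · rw [vv_eq, norm_mul, norm_pow]
      exact mul_le_one₀ (pow_le_one₀ (norm_nonneg _) (h j)) (norm_nonneg _)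
        (ih _ (Nat.div_lt_self hk (by have := hd (j + 1) (by omega); omega)) _)

/-! ### numeration facts -/

lemma q_succ (j : ℕ) : q d (j + 1) = q d j * d (j + 1) := by
  rw [q, Finset.prod_range_succ]; rfl

lemma q_pos (hd0 : d 0 = 1) (hd : ∀ j, 1 ≤ j → 2 ≤ d j) (j : ℕ) : 0 < q d j := by
  apply Finset.prod_pos
  intro i _
  rcases Nat.eq_zero_or_pos i with rfl | h
  · omega
  · have := hd i h; omega

lemma q_zero (hd0 : d 0 = 1) : q d 0 = 1 := by simp [q, hd0]

lemma q_strictMono (hd0 : d 0 = 1) (hd : ∀ j, 1 ≤ j → 2 ≤ d j) : StrictMono (q d) := by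
  apply strictMono_nat_of_lt_succ
  intro j
  rw [q_succ]
  have := q_pos hd0 hd j
  have := hd (j + 1) (by omega)
  nlinarith

lemma q_sum (hd0 : d 0 = 1) (hd : ∀ j, 1 ≤ j → 2 ≤ d j) (r : ℕ) :
    (∑ j ∈ Finset.Icc 1 r, (d j - 1) * q d (j - 1)) + 1 = q d r := by
  induction r with
  | zero => simp [q_zero hd0]
  | succ r ih =>
    rw [Finset.sum_Icc_succ_top (by omega), q_succ, Nat.add_sub_cancel]
    have := hd (r + 1) (by omega)
    obtain ⟨e, he⟩ : ∃ e, d (r + 1) = e + 1 := ⟨d (r + 1) - 1, by omega⟩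
    rw [he, Nat.add_sub_cancel]
    nlinarith

lemma zeta_mem (hd0 : d 0 = 1) (hd : ∀ j, 1 ≤ j → 2 ≤ d j) (n : ℕ) :
    1 ≤ zeta d n ∧ digit d n (zeta d n) ≠ d (zeta d n) - 1 := by
  have : ({j | 1 ≤ j ∧ digit d n j ≠ d j - 1} : Set ℕ).Nonempty := by
    refine ⟨n + 2, by omega, ?_⟩
    have h1 : n + 1 ≤ q d (n + 1) := (q_strictMono hd0 hd).id_le (n + 1)
    have := hd (n + 2) (by omega)
    rw [digit, show n + 2 - 1 = n + 1 by omega, Nat.div_eq_of_lt (by omega), Nat.zero_mod]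
    omega
  exact Nat.sInf_mem this

lemma digit_lt_zeta {n j : ℕ} (h1 : 1 ≤ j) (h : j < zeta d n) : digit d n j = d j - 1 := by
  by_contra hh
  exact Nat.notMem_of_lt_sInf h ⟨h1, hh⟩

lemma mod_q (hd0 : d 0 = 1) (hd : ∀ j, 1 ≤ j → 2 ≤ d j) (n r : ℕ) (h : r < zeta d n) :
    q d r * (n / q d r) + q d r = n + 1 := by
  suffices n % q d r + 1 = q d r by
    have := Nat.div_add_mod n (q d r); omega
  induction r with
  | zero => rw [q_zero hd0]; omega
  | succ r ih =>
    have h1 := ih (by omega)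
    have h2 := digit_lt_zeta (d := d) (n := n) (j := r + 1) (by omega) h
    rw [digit, Nat.add_sub_cancel] at h2
    rw [q_succ, Nat.mod_mul, h2]
    have := hd (r + 1) (by omega)
    obtain ⟨e, he⟩ : ∃ e, d (r + 1) = e + 1 := ⟨d (r + 1) - 1, by omega⟩
    rw [he, Nat.add_sub_cancel]
    nlinarith

lemma SS_unroll (hd0 : d 0 = 1) (hd : ∀ j, 1 ≤ j → 2 ≤ d j) (n : ℕ) (w : ℕ → ℂ) (J : ℕ)
    (hJ : J < zeta d n) :
    SS d p hd n 0 w = ∑ r ∈ Finset.range J, (1 - (p (r + 1) : ℂ)) *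
        (∏ j ∈ Finset.Icc 1 r, (p j : ℂ)) * w (q d r * (n / q d r)) +
      (∏ j ∈ Finset.Icc 1 J, (p j : ℂ)) *
        SS d p hd (n / q d J) J (fun m => w (q d J * m)) := by
  induction J with
  | zero => simp [q_zero hd0]
  | succ J ih =>
    rw [ih (by omega), Finset.sum_range_succ, SS_eq, BB]
    have h2 := digit_lt_zeta (d := d) (n := n) (j := J + 1) (by omega) hJ
    rw [digit, Nat.add_sub_cancel] at h2
    rw [if_neg (by have := hd (J + 1) (by omega); omega), Finset.prod_Icc_succ_top (by omega),
      Nat.div_div_eq_div_mul, ← q_succ]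
    have e : (fun m => w (q d J * (d (J + 1) * m))) = fun m => w (q d (J + 1) * m) := by
      funext m; rw [q_succ, mul_assoc]
    rw [e]
    ring

lemma SS_explicit (hd0 : d 0 = 1) (hd : ∀ j, 1 ≤ j → 2 ≤ d j) (n : ℕ) (w : ℕ → ℂ) :
    SS d p hd n 0 w = ∑ r ∈ Finset.range (zeta d n), (1 - (p (r + 1) : ℂ)) *
        (∏ j ∈ Finset.Icc 1 r, (p j : ℂ)) * w (q d r * (n / q d r)) +
      (∏ j ∈ Finset.Icc 1 (zeta d n), (p j : ℂ)) * w (n + 1) := by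
  obtain ⟨h1, h2⟩ := zeta_mem hd0 hd n
  obtain ⟨J, hJ⟩ : ∃ J, zeta d n = J + 1 := ⟨zeta d n - 1, by omega⟩
  rw [hJ, digit, Nat.add_sub_cancel] at h2
  have hD := hd (J + 1) (by omega)
  have := Nat.mod_lt (n / q d J) (show 0 < d (J + 1) by omega)
  rw [SS_unroll hd0 hd n w J (by omega), SS_eq, BB, if_pos (by omega), hJ,
    Finset.sum_range_succ, Finset.prod_Icc_succ_top (by omega),
    ← mod_q hd0 hd n J (by omega), show q d J * (n / q d J + 1) = q d J * (n / q d J) + q d J by ring]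
  ring

lemma s_top (n : ℕ) : s d p n (n + 1) = ∏ j ∈ Finset.Icc 1 (zeta d n), p j := by
  simp [s]

lemma s_mid (hd0 : d 0 = 1) (hd : ∀ j, 1 ≤ j → 2 ≤ d j) (n r : ℕ) (hr : r < zeta d n) :
    s d p n (q d r * (n / q d r)) = (1 - p (r + 1)) * ∏ j ∈ Finset.Icc 1 r, p j := by
  have hm := mod_q hd0 hd n r hr
  have hq := q_pos hd0 hd r
  rw [s, if_neg (by omega)]
  rcases Nat.eq_zero_or_pos r with rfl | h0
  · rw [q_zero hd0] at hm ⊢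
    rw [if_pos (by omega)]; simp
  · have h1 := q_strictMono hd0 hd h0
    rw [q_zero hd0] at h1
    rw [if_neg (by omega)]
    have hs := q_sum hd0 hd r
    have hex : ∃ r', 1 ≤ r' ∧ r' + 1 ≤ zeta d n ∧
      n = q d r * (n / q d r) + ∑ j ∈ Finset.Icc 1 r', (d j - 1) * q d (j - 1) :=
      ⟨r, h0, hr, by omega⟩
    rw [dif_pos hex]
    have hc := hex.choose_spec
    have : hex.choose = r := by
      have hs' := q_sum hd0 hd hex.choose
      apply (q_strictMono hd0 hd).injective
      omega
    rw [this]

lemma s_zero (hd0 : d 0 = 1) (hd : ∀ j, 1 ≤ j → 2 ≤ d j) (n m : ℕ) (h1 : m ≠ n + 1)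
    (h2 : ∀ r, r < zeta d n → m ≠ q d r * (n / q d r)) : s d p n m = 0 := by
  have hz := (zeta_mem hd0 hd n).1
  rw [s, if_neg h1, if_neg, dif_neg]
  · rintro ⟨r, h3, h4, h5⟩
    have hm := mod_q hd0 hd n r h4
    have hs := q_sum hd0 hd r
    exact h2 r h4 (by omega)
  · have := h2 0 (by omega)
    rwa [q_zero hd0, Nat.div_one, one_mul] at this

lemma tsum_eq_SS (hd0 : d 0 = 1) (hd : ∀ j, 1 ≤ j → 2 ≤ d j) (n : ℕ) (w : ℕ → ℂ) :
    ∑' m : ℕ, (s d p n m : ℂ) * w m = SS d p hd n 0 w := by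
  classical
  rw [SS_explicit hd0 hd]
  rw [tsum_eq_sum (s := insert (n + 1)
    ((Finset.range (zeta d n)).image (fun r => q d r * (n / q d r))))]
  · rw [Finset.sum_insert, Finset.sum_image, s_top, add_comm]
    · push_cast
      congr 1
      apply Finset.sum_congr rfl
      intro r hr
      rw [s_mid hd0 hd n r (Finset.mem_range.1 hr)]
      push_cast; rfl
    · intro a ha b hb hab
      have h1 := mod_q hd0 hd n a (by simpa using ha)
      have h2 := mod_q hd0 hd n b (by simpa using hb)
      apply (q_strictMono hd0 hd).injective
      simp only at hab
      omega
    · simp only [Finset.mem_image, Finset.mem_range, not_exists, not_and]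
      intro r hr
      have h1 := mod_q hd0 hd n r hr
      have := q_pos hd0 hd r
      omega
  · intro m hm
    simp only [Finset.mem_insert, Finset.mem_image, Finset.mem_range, not_or, not_exists,
      not_and] at hm
    rw [s_zero hd0 hd n m hm.1 (fun r hr h => hm.2 r hr h.symm)]
    simp

/-! ### operators -/

abbrev LL := lp (fun _ : ℕ => ℂ) ⊤

/-- `(U - (1-p))/p` -/
def AA (p : ℕ → ℝ) (j : ℕ) (U : LL →L[ℂ] LL) : LL →L[ℂ] LL :=
  ((p (j + 1) : ℂ)⁻¹) • (U - (1 - (p (j + 1) : ℂ)) • (1 : LL →L[ℂ] LL))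

def UU (d : ℕ → ℕ) (p : ℕ → ℝ) (T : LL →L[ℂ] LL) : ℕ → (LL →L[ℂ] LL)
  | 0 => T
  | j + 1 => (AA p j (UU d p T j)) ^ d (j + 1)

lemma UU_slice (hd0 : d 0 = 1) (hd : ∀ j, 1 ≤ j → 2 ≤ d j)
    (hp : ∀ j, 1 ≤ j → p j ∈ Set.Ioc (0 : ℝ) 1) (T : LL →L[ℂ] LL)
    (hT : ∀ (w : LL) (n : ℕ), T w n = ∑' m : ℕ, (s d p n m : ℂ) * w m) (j : ℕ) :
    ∀ (w : LL) (r k : ℕ), r < q d j →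
      (UU d p T j w) (r + q d j * k) = SS d p hd k j (fun m => w (r + q d j * m)) := by
  induction j with
  | zero =>
    intro w r k hr
    rw [q_zero hd0] at hr ⊢
    obtain rfl : r = 0 := by omega
    rw [UU, hT, tsum_eq_SS hd0 hd]
    simp
  | succ j ih =>
    intro w r k hr
    have h0 : (p (j + 1) : ℂ) ≠ 0 := by
      have := (hp (j + 1) (by omega)).1
      exact_mod_cast this.ne'
    have hA : ∀ (w : LL) (r : ℕ), r < q d j →
        (fun k => (AA p j (UU d p T j) w) (r + q d j * k)) =
          BB d p hd j (fun m => w (r + q d j * m)) := by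
      intro w r hr
      funext k
      have h1 := ih w r k hr
      rw [SS_eq] at h1
      have : (AA p j (UU d p T j) w) (r + q d j * k) = (p (j + 1) : ℂ)⁻¹ *
        ((UU d p T j w) (r + q d j * k) - (1 - (p (j + 1) : ℂ)) * w (r + q d j * k)) := rfl
      rw [this, h1]
      field_simp
      ring
    have hAi : ∀ (i : ℕ) (w : LL) (r : ℕ), r < q d j →
        (fun k => ((AA p j (UU d p T j) ^ i) w) (r + q d j * k)) =
          (BB d p hd j)^[i] (fun m => w (r + q d j * m)) := by
      intro i
      induction i with
      | zero => intro w r hr; rfl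
      | succ i ihi =>
        intro w r hr
        rw [Function.iterate_succ_apply', ← ihi w r hr, ← hA _ r hr, pow_succ']
        rfl
    have hq := q_pos hd0 hd j
    have hr1 : r % q d j < q d j := Nat.mod_lt _ hq
    have hr2 : r / q d j < d (j + 1) := by
      rw [Nat.div_lt_iff_lt_mul hq, mul_comm, ← q_succ]; exact hr
    have key : ∀ k, r + q d (j + 1) * k = r % q d j + q d j * (r / q d j + d (j + 1) * k) := by
      intro k
      rw [q_succ]
      have := Nat.mod_add_div r (q d j)
      nlinarith
    have h3 := congrFun (hAi (d (j + 1)) w (r % q d j) hr1) (r / q d j + d (j + 1) * k)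
    rw [BB_pow hd j k _ _ hr2] at h3
    simp only [← key] at h3
    exact h3

lemma UU_norm (hd0 : d 0 = 1) (hd : ∀ j, 1 ≤ j → 2 ≤ d j)
    (hp : ∀ j, 1 ≤ j → p j ∈ Set.Ioc (0 : ℝ) 1) (T : LL →L[ℂ] LL)
    (hT : ∀ (w : LL) (n : ℕ), T w n = ∑' m : ℕ, (s d p n m : ℂ) * w m) (j : ℕ) :
    ‖UU d p T j‖ ≤ 1 := by
  apply ContinuousLinearMap.opNorm_le_bound _ zero_le_one
  intro w
  rw [one_mul]
  apply lp.norm_le_of_forall_le (norm_nonneg _)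
  intro n
  have := UU_slice hd0 hd hp T hT j w (n % q d j) (n / q d j) (Nat.mod_lt _ (q_pos hd0 hd j))
  rw [Nat.mod_add_div] at this
  rw [this]
  apply SS_norm hd hp
  intro m
  exact lp.norm_apply_le_norm (by simp) w _

lemma UU_spec (T : LL →L[ℂ] LL) (lam : ℂ) (h : lam ∈ spectrum ℂ T) (j : ℕ) :
    ftil d p j lam ∈ spectrum ℂ (UU d p T j) := by
  induction j with
  | zero => exact h
  | succ j ih =>
    let P : Polynomial ℂ := (Polynomial.C ((p (j + 1) : ℂ)⁻¹) *
      (Polynomial.X - Polynomial.C (1 - (p (j + 1) : ℂ)))) ^ d (j + 1)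
    have h1 := spectrum.subset_polynomial_aeval (UU d p T j) P ⟨_, ih, rfl⟩
    have h2 : Polynomial.aeval (UU d p T j) P = UU d p T (j + 1) := by
      simp only [P, UU, AA]
      generalize (1 - (p (j + 1) : ℂ)) = c
      simp only [map_pow, map_mul, map_sub, Polynomial.aeval_C, Polynomial.aeval_X,
        Algebra.algebraMap_eq_smul_one, smul_mul_assoc, one_mul]
    have h3 : Polynomial.eval (ftil d p j lam) P = ftil d p (j + 1) lam := by
      simp only [P, Polynomial.eval_pow, Polynomial.eval_mul, Polynomial.eval_C,
        Polynomial.eval_sub, Polynomial.eval_X, ftil_succ, iota, Nat.add_sub_cancel]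
      congr 1
      rw [div_eq_inv_mul]
    simp only [h2] at h1
    rw [← h3]
    exact h1

lemma spec_le (hd0 : d 0 = 1) (hd : ∀ j, 1 ≤ j → 2 ≤ d j)
    (hp : ∀ j, 1 ≤ j → p j ∈ Set.Ioc (0 : ℝ) 1) (T : LL →L[ℂ] LL)
    (hT : ∀ (w : LL) (n : ℕ), T w n = ∑' m : ℕ, (s d p n m : ℂ) * w m) (lam : ℂ)
    (h : lam ∈ spectrum ℂ T) (j : ℕ) : ‖ftil d p j lam‖ ≤ 1 := by
  have h1 := spectrum.norm_le_norm_mul_of_mem (UU_spec (d := d) (p := p) T lam h j)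
  have h2 := UU_norm hd0 hd hp T hT j
  have h3 : ‖(1 : LL →L[ℂ] LL)‖ ≤ 1 := ContinuousLinearMap.norm_id_le
  calc _ ≤ _ := h1
    _ ≤ 1 * 1 := by gcongr
    _ = 1 := one_mul 1

lemma mem_E_iff (hd : ∀ j, 1 ≤ j → 2 ≤ d j)
    (hp : ∀ j, 1 ≤ j → p j ∈ Set.Ioc (0 : ℝ) 1) (lam : ℂ) :
    lam ∈ E d p ↔ ∀ j, ‖ftil d p j lam‖ ≤ 1 := by
  constructor
  · intro h j
    by_contra! hj
    set x := ‖ftil d p j lam‖ with hx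
    have grow : ∀ i, x ^ (i + 1) ≤ ‖ftil d p (j + i) lam‖ := by
      intro i
      induction i with
      | zero => simp [hx]
      | succ i ih =>
        set y := ‖ftil d p (j + i) lam‖ with hy
        have hx1 : x ≤ x ^ (i + 1) := le_self_pow₀ hj.le (by omega)
        have hy1 : 1 < y := by linarith
        obtain ⟨h0, h1⟩ := hp (j + i + 1) (by omega)
        have hi : y ≤ ‖iota d p lam (j + i + 1)‖ := by
          have e := iota_mul (d := d) hp (j + i) lam
          have e2 : ‖ftil d p (j + i) lam‖ ≤ (1 - p (j + i + 1)) +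
              p (j + i + 1) * ‖iota d p lam (j + i + 1)‖ := by
            rw [← e]
            refine (norm_add_le _ _).trans ?_
            have e3 : (1 - (p (j + i + 1) : ℂ)) = ((1 - p (j + i + 1) : ℝ) : ℂ) := by
              push_cast; rfl
            rw [norm_mul, e3, Complex.norm_real, Complex.norm_real, Real.norm_of_nonneg h0.le,
              Real.norm_of_nonneg (by linarith)]
          rw [← hy] at e2
          by_contra! hlt
          nlinarith
        rw [← add_assoc, ftil_succ, norm_pow]
        have hD := hd (j + i + 1) (by omega)
        calc x ^ (i + 1 + 1) = x ^ (i + 1) * x := pow_succ _ _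
          _ ≤ y * y := by gcongr; linarith
          _ = y ^ 2 := by ring
          _ ≤ ‖iota d p lam (j + i + 1)‖ ^ 2 := by gcongr
          _ ≤ _ := pow_le_pow_right₀ (by linarith) hD
    obtain ⟨C, hC1, hC2⟩ := exists_between (show Filter.limsup
      (fun j => (‖ftil d p j lam‖₊ : ℝ≥0∞)) Filter.atTop < ⊤ from h)
    have hev := Filter.eventually_lt_of_limsup_lt hC1
    obtain ⟨N, hN⟩ := Filter.eventually_atTop.1 hev
    lift C to NNReal using hC2.ne
    obtain ⟨m, hm⟩ := pow_unbounded_of_one_lt (C : ℝ) hj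
    have h1 := hN (j + (N + m)) (by omega)
    have h2 := grow (N + m)
    have h3 : ‖ftil d p (j + (N + m)) lam‖ < C := by exact_mod_cast h1
    have h4 : x ^ m ≤ x ^ (N + m + 1) := pow_le_pow_right₀ hj.le (by omega)
    linarith
  · intro h
    have : Filter.limsup (fun j => (‖ftil d p j lam‖₊ : ℝ≥0∞)) Filter.atTop ≤ 1 := by
      refine Filter.limsup_le_of_le (by isBoundedDefault) (Filter.Eventually.of_forall ?_)
      intro j
      exact_mod_cast h j
    exact lt_of_le_of_lt this ENNReal.one_lt_top

lemma E_sub_point (hd0 : d 0 = 1) (hd : ∀ j, 1 ≤ j → 2 ≤ d j)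
    (hp : ∀ j, 1 ≤ j → p j ∈ Set.Ioc (0 : ℝ) 1) (T : LL →L[ℂ] LL)
    (hT : ∀ (w : LL) (n : ℕ), T w n = ∑' m : ℕ, (s d p n m : ℂ) * w m) (lam : ℂ)
    (h : lam ∈ E d p) : lam ∈ pointSpectrum T := by
  rw [mem_E_iff hd hp] at h
  have hi : ∀ j, ‖iota d p lam (j + 1)‖ ≤ 1 := by
    intro j
    have h1 := h (j + 1)
    rw [ftil_succ, norm_pow] at h1
    exact (pow_le_one_iff_of_nonneg (norm_nonneg _)
      (by have := hd (j + 1) (by omega); omega)).1 h1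
  let v : LL := ⟨fun n => vv d p hd lam n 0, memℓp_infty ⟨1, by
    rintro _ ⟨n, rfl⟩
    exact vv_norm hd lam hi n 0⟩⟩
  refine ⟨v, ?_, ?_⟩
  · intro h0
    have h1 : v 0 = 0 := by rw [h0]; rfl
    have h2 : v 0 = 1 := vv_zero hd lam 0
    rw [h1] at h2
    exact zero_ne_one h2
  · ext n
    rw [hT, tsum_eq_SS hd0 hd]
    exact vv_eig hd hp lam n 0

lemma not_inj_of_point (T : LL →L[ℂ] LL) (lam : ℂ) (h : lam ∈ pointSpectrum T) :
    ¬ Function.Injective ⇑(T - lam • (1 : LL →L[ℂ] LL)) := by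
  obtain ⟨v, h0, hv⟩ := h
  intro hi
  apply h0
  apply hi
  simp [hv]

lemma spec_of_not_bij (T : LL →L[ℂ] LL) (lam : ℂ)
    (h : ¬ Function.Bijective ⇑(T - lam • (1 : LL →L[ℂ] LL))) : lam ∈ spectrum ℂ T := by
  rw [spectrum.mem_iff, ← IsUnit.neg_iff, neg_sub, Algebra.algebraMap_eq_smul_one]
  rwa [ContinuousLinearMap.isUnit_iff_bijective]

end Helpers

/-- on `l^∞`, `E = σ(S) = σ_p(S)`; consequently the residual and
continuous spectra of `S` on `l^∞` are empty. -/
theorem stmt6 (d : ℕ → ℕ) (p : ℕ → ℝ)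
    (hd0 : d 0 = 1) (hd : ∀ j, 1 ≤ j → 2 ≤ d j)
    (hp : ∀ j, 1 ≤ j → p j ∈ Set.Ioc (0 : ℝ) 1)
    (Tinf : lp (fun _ : ℕ => ℂ) ⊤ →L[ℂ] lp (fun _ : ℕ => ℂ) ⊤)
    (hTinf : ∀ (w : lp (fun _ : ℕ => ℂ) ⊤) (n : ℕ),
      Tinf w n = ∑' m : ℕ, (s d p n m : ℂ) * w m) :
    E d p = spectrum ℂ Tinf ∧ spectrum ℂ Tinf = pointSpectrum Tinf ∧
      residualSpectrum Tinf = ∅ ∧ continuousSpectrum Tinf = ∅ := by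
  have hEs : E d p ⊆ pointSpectrum Tinf := fun lam h => E_sub_point hd0 hd hp Tinf hTinf lam h
  have hps : pointSpectrum Tinf ⊆ spectrum ℂ Tinf := fun lam h =>
    spec_of_not_bij _ _ (fun hb => not_inj_of_point _ _ h hb.1)
  have hsE : spectrum ℂ Tinf ⊆ E d p := fun lam h =>
    (mem_E_iff hd hp lam).2 (spec_le hd0 hd hp Tinf hTinf lam h)
  refine ⟨Set.Subset.antisymm (hEs.trans hps) hsE, Set.Subset.antisymm (hsE.trans hEs) hps, ?_, ?_⟩
  · rw [Set.eq_empty_iff_forall_notMem]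
    rintro lam ⟨h1, h2⟩
    refine not_inj_of_point _ _ (hEs (hsE (spec_of_not_bij Tinf lam fun hb => h2 ?_))) h1
    exact hb.2.denseRange
  · rw [Set.eq_empty_iff_forall_notMem]
    rintro lam ⟨h1, _, h2⟩
    refine not_inj_of_point _ _ (hEs (hsE (spec_of_not_bij Tinf lam fun hb => h2 ?_))) h1
    exact hb.2.range_eq

end AMFC
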